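/- There exists a constant C, depending only on Ω and the geometric constants δ₀, δ₁ but not on ε, such that every φ ∈ H¹(Ω_ε) vanishing on the sieve Γ_ε satisfies the trace estimate ‖φ‖_{L²(Σ)} ≤ C √(r_ε) ‖∇φ‖_{L²(Ω_ε)}, where r_ε = exp(−ε^{−α}) is the hole-size parameter. -/

import Mathlib

open MeasureTheory Set

/-- Partial-derivative entry `∂ u_i / ∂ x_j` of a vector field on `ℝ³`. -/
noncomputable def Du (u : (Fin 3 → ℝ) → (Fin 3 → ℝ)) (x : Fin 3 → ℝ) (i j : Fin 3) : ℝ :=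
  fderiv ℝ (fun y => u y i) x (Pi.single j 1)

/-- Divergence of a vector field on `ℝ³`. -/
noncomputable def div3 (u : (Fin 3 → ℝ) → (Fin 3 → ℝ)) (x : Fin 3 → ℝ) : ℝ := ∑ i, Du u x i i

/-- `∇u · ∇v = ∑_{i,j} ∂_j u_i ∂_j v_i`. -/
noncomputable def gradDot (u v : (Fin 3 → ℝ) → (Fin 3 → ℝ)) (x : Fin 3 → ℝ) : ℝ :=
  ∑ i, ∑ j, Du u x i j * Du v x i j

/-- Skew-symmetric convective term `[∇u − (∇u)ᵀ]u · v`. -/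
noncomputable def convTerm (u v : (Fin 3 → ℝ) → (Fin 3 → ℝ)) (x : Fin 3 → ℝ) : ℝ :=
  ∑ i, (∑ j, (Du u x i j - Du u x j i) * u x j) * v x i

/-- Euclidean dot product of two vector fields at a point. -/
noncomputable def dot3 (f v : (Fin 3 → ℝ) → (Fin 3 → ℝ)) (x : Fin 3 → ℝ) : ℝ := ∑ i, f x i * v x i

/-- The open cylinder `Ω` of radius `R` and half-length `h`. -/
def cyl (R h : ℝ) : Set (Fin 3 → ℝ) :=
  {p | p 0 ^ 2 + p 1 ^ 2 < R ^ 2 ∧ -h < p 2 ∧ p 2 < h}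

/-- The lower half-cylinder `Ω₋`. -/
def cylMinus (R h : ℝ) : Set (Fin 3 → ℝ) :=
  {p | p 0 ^ 2 + p 1 ^ 2 < R ^ 2 ∧ -h < p 2 ∧ p 2 < 0}

/-- The upper half-cylinder `Ω₊`. -/
def cylPlus (R h : ℝ) : Set (Fin 3 → ℝ) :=
  {p | p 0 ^ 2 + p 1 ^ 2 < R ^ 2 ∧ 0 < p 2 ∧ p 2 < h}

/-- The lateral wall `𝓛` of the cylinder. -/
def lateral (R h : ℝ) : Set (Fin 3 → ℝ) :=
  {p | p 0 ^ 2 + p 1 ^ 2 = R ^ 2 ∧ -h ≤ p 2 ∧ p 2 ≤ h}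

/-- The middle cross-sectional disk `Σ` at height `z = 0`. -/
def midDisk (R : ℝ) : Set (Fin 3 → ℝ) :=
  {p | p 0 ^ 2 + p 1 ^ 2 < R ^ 2 ∧ p 2 = 0}

/-- The planar disk of radius `R` in `ℝ²`. -/
def disk2 (R : ℝ) : Set (ℝ × ℝ) := {q | q.1 ^ 2 + q.2 ^ 2 < R ^ 2}

/-- Embedding of a planar point at height `s`. -/
def emb (q : ℝ × ℝ) (s : ℝ) : Fin 3 → ℝ := ![q.1, q.2, s]

/-- The Bogovskii constant of a domain `Q ⊆ ℝ³`. -/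
noncomputable def bogConst (Q : Set (Fin 3 → ℝ)) : ℝ :=
  sSup {t : ℝ | ∃ g : (Fin 3 → ℝ) → ℝ,
    IntegrableOn (fun x => (g x) ^ 2) Q ∧ (∫ x in Q, g x) = 0 ∧ (∫ x in Q, (g x) ^ 2) ≠ 0 ∧
    t = sInf {s : ℝ | ∃ v : (Fin 3 → ℝ) → (Fin 3 → ℝ), Differentiable ℝ v ∧
        (∀ x ∉ Q, v x = 0) ∧ (∀ x ∈ Q, div3 v x = g x) ∧
        s = (∫ x in Q, ‖fderiv ℝ v x‖ ^ 2) ^ ((1:ℝ)/2) / (∫ x in Q, (g x) ^ 2) ^ ((1:ℝ)/2)}}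


lemma ftc_sq (g : ℝ → ℝ) (hg : Differentiable ℝ g) :
    ‖g 1 - g 0‖ₑ ^ 2 ≤ ∫⁻ t in Ioc (0:ℝ) 1, ‖deriv g t‖ₑ ^ 2 := by
  have hm : Measurable (deriv g) := measurable_deriv g
  have : IsProbabilityMeasure (volume.restrict (Ioc (0:ℝ) 1)) := ⟨by simp⟩
  by_cases hfin : ∫⁻ t in Ioc (0:ℝ) 1, ‖deriv g t‖ₑ ^ 2 = ⊤
  · rw [hfin]; exact le_top
  have h2 : eLpNorm (deriv g) 2 (volume.restrict (Ioc (0:ℝ) 1)) ^ 2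
      = ∫⁻ t in Ioc (0:ℝ) 1, ‖deriv g t‖ₑ ^ 2 := by
    have := eLpNorm_nnreal_pow_eq_lintegral (f := deriv g) (p := 2)
      (μ := volume.restrict (Ioc (0:ℝ) 1)) (by norm_num)
    simpa using this
  have h12 := eLpNorm_le_eLpNorm_of_exponent_le (μ := volume.restrict (Ioc (0:ℝ) 1))
    (p := 1) (q := 2) (by norm_num) hm.aestronglyMeasurable
  have hlt : eLpNorm (deriv g) 1 (volume.restrict (Ioc (0:ℝ) 1)) < ⊤ := by
    refine lt_of_le_of_lt h12 ?_
    rw [lt_top_iff_ne_top]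
    intro h
    rw [h] at h2
    apply hfin
    rw [← h2]; simp
  have hint : IntegrableOn (deriv g) (Ioc 0 1) :=
    memLp_one_iff_integrable.1 ⟨hm.aestronglyMeasurable, hlt⟩
  have hI : ∫ t in (0:ℝ)..1, deriv g t = g 1 - g 0 :=
    intervalIntegral.integral_deriv_eq_sub (fun x _ => hg x)
      ((intervalIntegrable_iff_integrableOn_Ioc_of_le zero_le_one).2 hint)
  rw [← h2, ← hI, intervalIntegral.integral_of_le zero_le_one]
  gcongr
  refine le_trans (enorm_integral_le_lintegral_enorm _) ?_
  rw [← eLpNorm_one_eq_lintegral_enorm]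
  exact h12

lemma emb_apply_cont : Continuous (fun p : (ℝ × ℝ) × ℝ => emb p.1 p.2) := by
  refine continuous_pi fun i => ?_
  fin_cases i <;> simp [emb] <;> fun_prop

lemma lintegral_emb (f : (Fin 3 → ℝ) → ENNReal) (hf : Measurable f) :
    ∫⁻ x, f x = ∫⁻ z : ℝ, ∫⁻ q : ℝ × ℝ, f (emb q z) := by
  have e1 := (volume_preserving_piFinSuccAbove (fun _ : Fin 3 => ℝ) 2).symm
  have e2 := (volume_preserving_finTwoArrow ℝ).symm
  rw [← e1.lintegral_comp hf, Measure.volume_eq_prod, lintegral_prod _ (by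
    exact (hf.comp e1.measurable).aemeasurable)]
  refine lintegral_congr fun z => ?_
  rw [← e2.lintegral_comp (by
    exact hf.comp (e1.measurable.comp (measurable_const.prodMk measurable_id)))]
  refine lintegral_congr fun q => ?_
  congr 1
  ext i
  fin_cases i
  · rfl
  · rfl
  · rfl

lemma lintegral_aff (f : ℝ × ℝ → ENNReal) (hf : Measurable f) (w : ℝ × ℝ) (l c : ℝ) (hc : 0 < c)
    (hcl : c ≤ l) : ∫⁻ q, f (w + l • q) ≤ ENNReal.ofReal ((c ^ 2)⁻¹) * ∫⁻ q, f q := by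
  have hl : 0 < l := hc.trans_le hcl
  have h1 : ∫⁻ q, f (w + l • q) = ∫⁻ q, f (w + q) ∂(Measure.map (fun q : ℝ × ℝ => l • q) volume) := by
    rw [lintegral_map (by fun_prop) (by fun_prop)]
  rw [h1, Measure.map_addHaar_smul _ hl.ne', lintegral_smul_measure,
    lintegral_add_left_eq_self]
  simp only [Module.finrank_prod, Module.finrank_self, smul_eq_mul]
  gcongr
  rw [abs_of_pos (by positivity)]
  norm_num
  gcongr

lemma leg (φ : (Fin 3 → ℝ) → ℝ) (hφ : Differentiable ℝ φ) (S : Set (ℝ × ℝ)) (hS : MeasurableSet S)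
    (W : Set (Fin 3 → ℝ)) (hW : MeasurableSet W) (u v : ℝ × ℝ) (c c0 c1 H M : ℝ)
    (hc : 0 < c) (hc0 : c ≤ c0) (hc1 : c ≤ c1) (hH : 0 < H)
    (hM : ∀ q ∈ S, ‖v + (c1 - c0) • q‖ ≤ M) (hHM : H ≤ M)
    (hSW : ∀ q ∈ S, ∀ t ∈ Ioo (0:ℝ) 1, emb (u + c0 • q + t • (v + (c1 - c0) • q)) (t * H) ∈ W) :
    ∫⁻ q in S, ‖φ (emb (u + v + c1 • q) H) - φ (emb (u + c0 • q) 0)‖ₑ ^ 2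
      ≤ ENNReal.ofReal (M ^ 2 * (c ^ 2)⁻¹ * H⁻¹) * ∫⁻ x in W, ‖fderiv ℝ φ x‖ₑ ^ 2 := by
  have hM0 : 0 ≤ M := hH.le.trans hHM
  set G : (Fin 3 → ℝ) → ENNReal := W.indicator (fun x => ‖fderiv ℝ φ x‖ₑ ^ 2) with hG
  have hGm : Measurable G := by
    refine Measurable.indicator ?_ hW
    exact (measurable_fderiv ℝ φ).enorm.pow_const 2
  have hGe : Measurable (fun p : (ℝ × ℝ) × ℝ => G (emb p.1 p.2)) :=
    hGm.comp emb_apply_cont.measurable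
  -- pointwise bound
  have hpt : ∀ q ∈ S, ‖φ (emb (u + v + c1 • q) H) - φ (emb (u + c0 • q) 0)‖ₑ ^ 2 ≤
      ENNReal.ofReal (M ^ 2) * ∫⁻ t in Ioc (0:ℝ) 1,
        G (emb (u + c0 • q + t • (v + (c1 - c0) • q)) (t * H)) := by
    intro q hq
    set d := emb (v + (c1 - c0) • q) H with hd
    have hline : ∀ t : ℝ, emb (u + c0 • q + t • (v + (c1 - c0) • q)) (t * H)
        = emb (u + c0 • q) 0 + t • d := by
      intro t
      ext i
      fin_cases i <;> simp [emb, hd] <;> ring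
    have hdn : ‖d‖ ≤ M := by
      rw [pi_norm_le_iff_of_nonneg hM0]
      have h1 := hM q hq
      rw [Prod.norm_def, max_le_iff] at h1
      intro i
      fin_cases i
      · exact h1.1
      · exact h1.2
      · simpa [hd, emb, abs_of_pos hH] using hHM
    have hder : ∀ t : ℝ, HasDerivAt (fun t : ℝ => φ (emb (u + c0 • q) 0 + t • d))
        (fderiv ℝ φ (emb (u + c0 • q) 0 + t • d) d) t := by
      intro t
      have h1 : HasDerivAt (fun t : ℝ => emb (u + c0 • q) 0 + t • d) d t := by
        simpa using ((hasDerivAt_id t).smul_const d).const_add (emb (u + c0 • q) 0)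
      exact (hφ _).hasFDerivAt.comp_hasDerivAt t h1
    have h := ftc_sq _ (fun t => (hder t).differentiableAt)
    have e1 : emb (u + v + c1 • q) H = emb (u + c0 • q) 0 + (1:ℝ) • d := by
      rw [← hline 1]
      congr 1
      · module
      · ring
    have e0 : emb (u + c0 • q) 0 = emb (u + c0 • q) 0 + (0:ℝ) • d := by simp
    rw [e1]
    nth_rewrite 2 [e0]
    refine h.trans ?_
    rw [← lintegral_const_mul' _ _ ENNReal.ofReal_ne_top, ← restrict_Ioo_eq_restrict_Ioc]
    refine setLIntegral_mono' measurableSet_Ioo fun t ht => ?_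
    have hw := hSW q hq t ht
    rw [hline t] at hw ⊢
    rw [(hder t).deriv, hG, indicator_of_mem hw, ENNReal.ofReal_pow hM0, ← mul_pow]
    gcongr
    refine (ContinuousLinearMap.le_opENorm _ _).trans ?_
    rw [mul_comm]
    gcongr
    rw [← ofReal_norm]
    exact ENNReal.ofReal_le_ofReal hdn
  have hmeas : Measurable (fun p : (ℝ × ℝ) × ℝ =>
      G (emb (u + c0 • p.1 + p.2 • (v + (c1 - c0) • p.1)) (p.2 * H))) := by
    exact hGe.comp (f := fun p : (ℝ × ℝ) × ℝ =>
      ((u + c0 • p.1 + p.2 • (v + (c1 - c0) • p.1), p.2 * H) : (ℝ × ℝ) × ℝ)) (by fun_prop)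
  have hrow : Measurable fun z : ℝ => ∫⁻ q : ℝ × ℝ, G (emb q z) :=
    Measurable.lintegral_prod_left' hGe
  calc _ ≤ ∫⁻ q in S, ENNReal.ofReal (M ^ 2) * ∫⁻ t in Ioc (0:ℝ) 1,
        G (emb (u + c0 • q + t • (v + (c1 - c0) • q)) (t * H)) := setLIntegral_mono' hS hpt
    _ = ENNReal.ofReal (M ^ 2) * ∫⁻ t in Ioc (0:ℝ) 1, ∫⁻ q in S,
        G (emb (u + c0 • q + t • (v + (c1 - c0) • q)) (t * H)) := by
      rw [lintegral_const_mul' _ _ ENNReal.ofReal_ne_top, lintegral_lintegral_swap]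
      exact hmeas.aemeasurable
    _ ≤ ENNReal.ofReal (M ^ 2) * ∫⁻ t in Ioc (0:ℝ) 1, ENNReal.ofReal ((c ^ 2)⁻¹) *
          ∫⁻ q, G (emb q (t * H)) := by
      refine mul_le_mul_right ?_ _
      refine setLIntegral_mono' measurableSet_Ioc fun t ht => ?_
      refine (setLIntegral_le_lintegral _ _).trans ?_
      have hl : c ≤ (1 - t) * c0 + t * c1 := by
        nlinarith [ht.1, ht.2]
      refine le_trans (le_of_eq ?_) (lintegral_aff (fun q => G (emb q (t * H)))
        (hGe.comp (measurable_id.prodMk measurable_const)) (u + t • v) _ c hc hl)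
      refine lintegral_congr fun q => ?_
      congr 2
      module
    _ ≤ ENNReal.ofReal (M ^ 2) * (ENNReal.ofReal ((c ^ 2)⁻¹) *
          (ENNReal.ofReal H⁻¹ * ∫⁻ x, G x)) := by
      refine mul_le_mul_right ?_ _
      rw [lintegral_const_mul' _ _ ENNReal.ofReal_ne_top]
      refine mul_le_mul_right ?_ _
      refine (setLIntegral_le_lintegral _ _).trans ?_
      rw [lintegral_emb G hGm]
      have h1 : ∫⁻ t : ℝ, ∫⁻ q : ℝ × ℝ, G (emb q (t * H))
          = ∫⁻ z, (∫⁻ q : ℝ × ℝ, G (emb q z)) ∂(Measure.map (fun t : ℝ => t * H) volume) := by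
        rw [lintegral_map hrow (by fun_prop)]
      rw [h1, Real.map_volume_mul_right hH.ne', lintegral_smul_measure, abs_of_pos (by positivity)]
      rfl
    _ = _ := by
      rw [hG, lintegral_indicator hW, ENNReal.ofReal_mul (by positivity),
        ENNReal.ofReal_mul (by positivity)]
      ring

lemma meas_disk (R : ℝ) : MeasurableSet (disk2 R) := by
  unfold disk2
  exact measurableSet_lt (by fun_prop) (by fun_prop)

lemma meas_cyl (R h : ℝ) : MeasurableSet (cyl R h) := by
  have h1 : MeasurableSet {p : Fin 3 → ℝ | p 0 ^ 2 + p 1 ^ 2 < R ^ 2} :=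
    measurableSet_lt (by fun_prop) (by fun_prop)
  have h2 : MeasurableSet {p : Fin 3 → ℝ | -h < p 2} :=
    measurableSet_lt (by fun_prop) (by fun_prop)
  have h3 : MeasurableSet {p : Fin 3 → ℝ | p 2 < h} :=
    measurableSet_lt (by fun_prop) (by fun_prop)
  exact h1.inter (h2.inter h3)

lemma emb_mem_cyl {R h z : ℝ} {q : ℝ × ℝ} (hq : q ∈ disk2 R) (h1 : -h < z) (h2 : z < h) :
    emb q z ∈ cyl R h := by
  refine ⟨?_, ?_, ?_⟩
  · simpa [emb, disk2] using hq
  · simpa [emb] using h1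
  · simpa [emb] using h2

lemma vee (φ : (Fin 3 → ℝ) → ℝ) (hφ : Differentiable ℝ φ) (S : Set (ℝ × ℝ)) (hS : MeasurableSet S)
    (R h : ℝ) (p : ℝ × ℝ) (s H M : ℝ) (hs : 0 < s) (hs1 : s ≤ 1) (hH : 0 < H) (hHh : H ≤ h)
    (hHM : H ≤ M) (hM : ∀ q ∈ S, ‖p + (s - 1) • q‖ ≤ M)
    (hseg : ∀ q ∈ S, ∀ t ∈ Icc (0:ℝ) 1, q + t • (p + (s - 1) • q) ∈ disk2 R)
    (hz : ∀ q ∈ S, φ (emb (p + s • q) 0) = 0) :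
    ∫⁻ q in S, ‖φ (emb q 0)‖ₑ ^ 2 ≤ ENNReal.ofReal (4 * (M ^ 2 * (s ^ 2)⁻¹ * H⁻¹)) *
      ∫⁻ x in cyl R h, ‖fderiv ℝ φ x‖ₑ ^ 2 := by
  have hM0 : 0 ≤ M := hH.le.trans hHM
  have hhalf : ∀ q ∈ S, ‖(1/2:ℝ) • (p + (s - 1) • q)‖ ≤ M := by
    intro q hq
    rw [norm_smul]
    have := hM q hq
    norm_num
    linarith
  have l1 := leg φ hφ S hS (cyl R h) (meas_cyl R h) 0 ((1/2:ℝ) • p) s 1 ((1+s)/2) H M hs hs1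
    (by linarith) hH (fun q hq => by
      have e : (1/2:ℝ) • p + ((1+s)/2 - 1) • q = (1/2:ℝ) • (p + (s - 1) • q) := by module
      rw [e]; exact hhalf q hq) hHM (fun q hq t ht => by
      refine emb_mem_cyl ?_ (by nlinarith [ht.1]) (by nlinarith [ht.2])
      have e : 0 + (1:ℝ) • q + t • ((1/2:ℝ) • p + ((1+s)/2 - 1) • q)
        = q + (t/2) • (p + (s - 1) • q) := by module
      rw [e]
      exact hseg q hq _ ⟨by linarith [ht.1], by linarith [ht.2]⟩)
  have l2 := leg φ hφ S hS (cyl R h) (meas_cyl R h) p (-((1/2:ℝ) • p)) s s ((1+s)/2) H M hs le_rfl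
    (by linarith) hH (fun q hq => by
      have e : -((1/2:ℝ) • p) + ((1+s)/2 - s) • q = -((1/2:ℝ) • (p + (s - 1) • q)) := by module
      rw [e, norm_neg]; exact hhalf q hq) hHM (fun q hq t ht => by
      refine emb_mem_cyl ?_ (by nlinarith [ht.1]) (by nlinarith [ht.2])
      have e : p + s • q + t • (-((1/2:ℝ) • p) + ((1+s)/2 - s) • q)
        = q + (1 - t/2) • (p + (s - 1) • q) := by module
      rw [e]
      exact hseg q hq _ ⟨by linarith [ht.2], by linarith [ht.1]⟩)
  have key : ∀ q ∈ S, ‖φ (emb q 0)‖ₑ ^ 2 ≤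
      2 * ‖φ (emb (0 + (1/2:ℝ) • p + ((1+s)/2) • q) H) - φ (emb (0 + (1:ℝ) • q) 0)‖ₑ ^ 2 +
      2 * ‖φ (emb (p + -((1/2:ℝ) • p) + ((1+s)/2) • q) H) - φ (emb (p + s • q) 0)‖ₑ ^ 2 := by
    intro q hq
    rw [hz q hq]
    have e1 : 0 + (1/2:ℝ) • p + ((1+s)/2) • q = p + -((1/2:ℝ) • p) + ((1+s)/2) • q := by module
    have e2 : 0 + (1:ℝ) • q = q := by module
    rw [e1, e2]
    generalize φ (emb (p + -((1/2:ℝ) • p) + ((1+s)/2) • q) H) = b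
    generalize φ (emb q 0) = a
    have e : ∀ x : ℝ, ‖x‖ₑ ^ 2 = ENNReal.ofReal (x ^ 2) := by
      intro x
      rw [Real.enorm_eq_ofReal_abs, ← ENNReal.ofReal_pow (abs_nonneg _), sq_abs]
    have e3 : (2 : ENNReal) = ENNReal.ofReal 2 := by simp
    rw [e, e, e, e3, ← ENNReal.ofReal_mul (by norm_num), ← ENNReal.ofReal_mul (by norm_num),
      ← ENNReal.ofReal_add (by positivity) (by positivity)]
    apply ENNReal.ofReal_le_ofReal
    nlinarith [sq_nonneg (2 * b - a)]
  have hcont : Continuous φ := hφ.continuous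
  have hec : ∀ (w : ℝ × ℝ) (k z : ℝ), Continuous fun q : ℝ × ℝ => φ (emb (w + k • q) z) := by
    intro w k z
    exact hcont.comp (emb_apply_cont.comp
      (f := fun q : ℝ × ℝ => ((w + k • q, z) : (ℝ × ℝ) × ℝ)) (by fun_prop))
  refine (setLIntegral_mono' hS key).trans ?_
  rw [lintegral_add_left' (by
      exact ((((hec _ _ _).sub (hec _ _ _)).measurable.enorm.pow_const 2).const_mul 2).aemeasurable),
    lintegral_const_mul' _ _ (by norm_num), lintegral_const_mul' _ _ (by norm_num)]
  refine (add_le_add (mul_le_mul_right l1 2) (mul_le_mul_right l2 2)).trans (le_of_eq ?_)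
  rw [ENNReal.ofReal_mul (p := 4) (by norm_num)]
  have e4 : ENNReal.ofReal 4 = 4 := by simp
  rw [e4]
  ring

lemma final_conv (φ : (Fin 3 → ℝ) → ℝ) (R h A B : ℝ) (hA : 0 ≤ A) (hAB : A ≤ B) (Z : Set (Fin 3 → ℝ))
    (hZ : Z ⊆ {p | p 2 = 0})
    (hi : IntegrableOn (fun q => (φ (emb q 0)) ^ 2) (disk2 R))
    (hj : IntegrableOn (fun x => ‖fderiv ℝ φ x‖ ^ 2) (cyl R h \ closure Z))
    (hm : ∫⁻ q in disk2 R, ‖φ (emb q 0)‖ₑ ^ 2 ≤ ENNReal.ofReal A *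
      ∫⁻ x in cyl R h, ‖fderiv ℝ φ x‖ₑ ^ 2) :
    ∫ q in disk2 R, (φ (emb q 0)) ^ 2 ≤ B * ∫ x in cyl R h \ closure Z, ‖fderiv ℝ φ x‖ ^ 2 := by
  have hcl : closure Z ⊆ {p | p 2 = 0} :=
    closure_minimal hZ (isClosed_eq (continuous_apply 2) continuous_const)
  have hnull : volume (closure Z) = 0 := by
    refine measure_mono_null hcl ?_
    exact Measure.pi_hyperplane (fun _ : Fin 3 => (volume : Measure ℝ)) 2 0
  have hae : (cyl R h \ closure Z : Set (Fin 3 → ℝ)) =ᵐ[volume] cyl R h :=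
    sdiff_null_ae_eq_self hnull
  have e1 : ∫⁻ q in disk2 R, ‖φ (emb q 0)‖ₑ ^ 2
      = ENNReal.ofReal (∫ q in disk2 R, (φ (emb q 0)) ^ 2) := by
    rw [ofReal_integral_eq_lintegral_ofReal hi (Filter.Eventually.of_forall fun q => sq_nonneg _)]
    refine lintegral_congr fun q => ?_
    rw [Real.enorm_eq_ofReal_abs, ← ENNReal.ofReal_pow (abs_nonneg _), sq_abs]
  have e2 : ∫⁻ x in cyl R h, ‖fderiv ℝ φ x‖ₑ ^ 2
      = ENNReal.ofReal (∫ x in cyl R h \ closure Z, ‖fderiv ℝ φ x‖ ^ 2) := by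
    rw [ofReal_integral_eq_lintegral_ofReal hj (Filter.Eventually.of_forall fun q => sq_nonneg _),
      setLIntegral_congr hae]
    refine lintegral_congr fun q => ?_
    rw [ENNReal.ofReal_pow (norm_nonneg _), ofReal_norm]
  have hJ : 0 ≤ ∫ x in cyl R h \ closure Z, ‖fderiv ℝ φ x‖ ^ 2 :=
    integral_nonneg fun _ => sq_nonneg _
  rw [e1, e2, ← ENNReal.ofReal_mul hA, ENNReal.ofReal_le_ofReal_iff (by positivity)] at hm
  exact hm.trans (mul_le_mul_of_nonneg_right hAB hJ)

lemma exists_X (α k : ℝ) (hα : 0 < α) (hk : 0 < k) :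
    ∃ X : ℝ, ∀ ε > 0, k * ε < Real.exp (-ε ^ (-α)) → ε ^ (-α) < X := by
  have ht := tendsto_rpow_mul_exp_neg_mul_atTop_nhds_zero (1/α) 1 one_pos
  obtain ⟨X, hX⟩ := Filter.eventually_atTop.1 (ht.eventually (gt_mem_nhds hk))
  refine ⟨X, fun ε hε hlt => ?_⟩
  by_contra hcon
  have h1 := hX _ (not_lt.1 hcon)
  rw [← Real.rpow_mul hε.le] at h1
  have h2 : -α * (1/α) = -1 := by field_simp
  rw [h2, Real.rpow_neg_one, neg_one_mul] at h1
  have h3 : ε * (ε⁻¹ * Real.exp (-ε ^ (-α))) < ε * k := by gcongr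
  rw [← mul_assoc, mul_inv_cancel₀ hε.ne', one_mul] at h3
  linarith

lemma case_far (φ : (Fin 3 → ℝ) → ℝ) (hφ : Differentiable ℝ φ) (R h δ₀ r a : ℝ) (hh : 0 < h)
    (hδ₀ : 0 < δ₀) (hr : 0 < r) (hr1 : r ≤ 1) (h3 : 3 * (δ₀ * r) ≤ a)
    (N : ℕ) (ξ : Fin N → ℝ × ℝ) (K : Fin N → Set (ℝ × ℝ))
    (hK : ∀ n, K n ⊆ Metric.ball (ξ n) (δ₀ * r))
    (hb : ∀ n, Metric.ball (ξ n) a ⊆ disk2 R)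
    (hd : Pairwise fun n m => Disjoint (Metric.ball (ξ n) a) (Metric.ball (ξ m) a))
    (hz : ∀ q : ℝ × ℝ, q ∈ disk2 R → (∀ n, q ∉ K n) → φ (emb q 0) = 0) :
    ∫⁻ q in disk2 R, ‖φ (emb q 0)‖ₑ ^ 2 ≤ ENNReal.ofReal (4 * (2 * δ₀ + h) ^ 2 * h⁻¹ * r) *
      ∫⁻ x in cyl R h, ‖fderiv ℝ φ x‖ₑ ^ 2 := by
  set b := δ₀ * r with hbdef
  have hbpos : 0 < b := by positivity
  set S : Set (ℝ × ℝ) := ⋃ n, Metric.ball (ξ n) b with hSdef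
  have hSm : MeasurableSet S := MeasurableSet.iUnion fun n => Metric.isOpen_ball.measurableSet
  have hmove : ∀ n, ∀ q ∈ Metric.ball (ξ n) b, ∀ t ∈ Icc (0:ℝ) 1,
      q + t • ((2 * b, 0) + ((1:ℝ) - 1) • q) ∈ Metric.ball (ξ n) a := by
    intro n q hq t ht
    rw [mem_ball_iff_norm, Prod.norm_def, max_lt_iff] at hq ⊢
    simp only [Prod.fst_sub, Prod.snd_sub, Real.norm_eq_abs, abs_lt, Prod.fst_add, Prod.snd_add,
      Prod.smul_fst, Prod.smul_snd, smul_eq_mul] at hq ⊢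
    obtain ⟨⟨q1, q2⟩, q3, q4⟩ := hq
    obtain ⟨t1, t2⟩ := ht
    refine ⟨⟨?_, ?_⟩, ?_, ?_⟩ <;> nlinarith
  have hv := vee φ hφ S hSm R h (2 * b, 0) 1 (h * r) ((2 * δ₀ + h) * r) one_pos le_rfl
    (by positivity) (by nlinarith) (by nlinarith [mul_pos hδ₀ hr]) (by
      intro q hq
      simp only [sub_self, zero_smul, add_zero, Prod.norm_def, Real.norm_eq_abs, abs_zero]
      rw [abs_of_pos (by positivity), max_le_iff]
      constructor
      · rw [hbdef]; nlinarith [mul_pos hh hr]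
      · positivity)
    (by
      intro q hq t ht
      obtain ⟨n, hn⟩ := mem_iUnion.1 hq
      exact hb n (hmove n q hn t ht))
    (by
      intro q hq
      obtain ⟨n, hn⟩ := mem_iUnion.1 hq
      have h1 := hmove n q hn 1 ⟨zero_le_one, le_rfl⟩
      have e : q + (1:ℝ) • ((2 * b, 0) + ((1:ℝ) - 1) • q) = (2 * b, 0) + (1:ℝ) • q := by module
      rw [e] at h1
      refine hz _ (hb n h1) fun m hm => ?_
      have h2 := hK m hm
      by_cases hnm : n = m
      · subst hnm
        rw [mem_ball_iff_norm, Prod.norm_def, max_lt_iff] at hn h2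
        simp only [Prod.fst_sub, Prod.snd_sub, Real.norm_eq_abs, abs_lt, Prod.fst_add,
          Prod.snd_add, Prod.smul_fst, Prod.smul_snd, smul_eq_mul] at hn h2
        linarith [hn.1.1, h2.1.2]
      · exact Set.disjoint_left.1 (hd hnm) h1 (Metric.ball_subset_ball (by linarith) h2))
  have hle : ∫⁻ q in disk2 R, ‖φ (emb q 0)‖ₑ ^ 2 ≤ ∫⁻ q in S, ‖φ (emb q 0)‖ₑ ^ 2 := by
    rw [← lintegral_indicator (meas_disk R), ← lintegral_indicator hSm]
    refine lintegral_mono fun q => ?_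
    by_cases hqS : q ∈ S
    · rw [indicator_of_mem hqS]
      exact indicator_le_self _ _ _
    · by_cases hqD : q ∈ disk2 R
      · rw [indicator_of_mem hqD, hz q hqD fun n hn => hqS (mem_iUnion.2 ⟨n, hK n hn⟩)]
        simp
      · rw [indicator_of_notMem hqD]
        exact zero_le
  refine hle.trans (hv.trans (le_of_eq ?_))
  congr 2
  field_simp

lemma case_near (φ : (Fin 3 → ℝ) → ℝ) (hφ : Differentiable ℝ φ) (R h a₁ a : ℝ) (hR : 0 < R)
    (hh : 0 < h) (ha₁ : 0 < a₁) (haR : a₁ ≤ R) (ha : a₁ ≤ a)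
    (N : ℕ) (ξ : Fin N → ℝ × ℝ) (K : Fin N → Set (ℝ × ℝ))
    (hK : ∀ n, K n ⊆ Metric.ball (ξ n) a)
    (hb : ∀ n, Metric.ball (ξ n) a ⊆ disk2 R)
    (hz : ∀ q : ℝ × ℝ, q ∈ disk2 R → (∀ n, q ∉ K n) → φ (emb q 0) = 0) :
    ∫⁻ q in disk2 R, ‖φ (emb q 0)‖ₑ ^ 2 ≤
      ENNReal.ofReal (4 * ((2 * R + h) ^ 2 * ((a₁ ^ 2 / (16 * R ^ 2)) ^ 2)⁻¹ * h⁻¹)) *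
      ∫⁻ x in cyl R h, ‖fderiv ℝ φ x‖ₑ ^ 2 := by
  set s := a₁ ^ 2 / (16 * R ^ 2) with hs
  have hspos : 0 < s := by positivity
  have hsR : s * (16 * R ^ 2) = a₁ ^ 2 := by rw [hs]; field_simp
  have hs1 : s ≤ 1 / 16 := by
    rw [hs, div_le_div_iff₀ (by positivity) (by norm_num)]
    nlinarith
  have hconv : ∀ q ∈ disk2 R, ∀ t : ℝ, 0 < t → t ≤ 1 → t • q + (1 - t) • (0, R) ∈ disk2 R := by
    intro q hq t h0 h1
    simp only [disk2, mem_ofPred_eq, Prod.fst_add, Prod.snd_add, Prod.smul_fst, Prod.smul_snd,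
      smul_eq_mul, mul_zero, add_zero] at hq ⊢
    have hy : q.2 ≤ R := by nlinarith [sq_nonneg q.1]
    nlinarith [mul_nonneg (mul_nonneg h0.le (sub_nonneg.2 h1)) (mul_nonneg hR.le (sub_nonneg.2 hy)),
      mul_pos (mul_pos h0 h0) (sub_pos.2 hq)]
  refine vee φ hφ (disk2 R) (meas_disk R) R h ((1 - s) • (0, R)) s h (2 * R + h) hspos
    (by linarith) hh le_rfl (by linarith) ?_ ?_ ?_
  · intro q hq
    have hq' : q.1 ^ 2 + q.2 ^ 2 < R ^ 2 := hq
    have hx : |q.1| ≤ R := abs_le_of_sq_le_sq (by nlinarith [sq_nonneg q.2]) hR.le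
    have hy : |q.2| ≤ R := abs_le_of_sq_le_sq (by nlinarith [sq_nonneg q.1]) hR.le
    rw [abs_le] at hx hy
    rw [Prod.norm_def, max_le_iff]
    simp only [Prod.fst_add, Prod.snd_add, Prod.smul_fst, Prod.smul_snd, smul_eq_mul,
      Real.norm_eq_abs, abs_le]
    refine ⟨⟨?_, ?_⟩, ?_, ?_⟩ <;> nlinarith
  · intro q hq t ht
    have e : q + t • ((1 - s) • ((0, R) : ℝ × ℝ) + (s - 1) • q)
        = (1 - t * (1 - s)) • q + (1 - (1 - t * (1 - s))) • (0, R) := by module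
    rw [e]
    exact hconv q hq _ (by nlinarith [ht.1, ht.2]) (by nlinarith [ht.1, ht.2])
  · intro q hq
    have h1 := hconv q hq s hspos (by linarith)
    rw [add_comm] at h1
    refine hz _ h1 fun n hn => ?_
    have h2 := hK n hn
    have hq' : q.1 ^ 2 + q.2 ^ 2 < R ^ 2 := hq
    have hy : |q.2| ≤ R := abs_le_of_sq_le_sq (by nlinarith [sq_nonneg q.1]) hR.le
    rw [abs_le] at hy
    set Y := (1 - s) * R + s * q.2 with hY
    have hYlow : R - 2 * s * R ≤ Y := by rw [hY]; nlinarith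
    have hYsq : R ^ 2 - a₁ ^ 2 / 4 ≤ Y ^ 2 := by
      have h0 : 0 ≤ R - 2 * s * R := by nlinarith
      have : (R - 2 * s * R) ^ 2 ≤ Y ^ 2 := by gcongr
      nlinarith [sq_nonneg (s * R)]
    have hYb : |Y - (ξ n).2| < a := by
      rw [mem_ball_iff_norm, Prod.norm_def, max_lt_iff] at h2
      simpa [hY] using h2.2
    have hmem : ∀ x : ℝ, |x - (ξ n).1| < a → x ^ 2 + Y ^ 2 < R ^ 2 := by
      intro x hx
      have : ((x, Y) : ℝ × ℝ) ∈ disk2 R := by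
        apply hb n
        rw [mem_ball_iff_norm, Prod.norm_def, max_lt_iff]
        exact ⟨hx, hYb⟩
      exact this
    have m1 := hmem ((ξ n).1 + a₁ / 2) (by
      rw [add_sub_cancel_left, abs_of_pos (by positivity)]; linarith)
    have m2 := hmem ((ξ n).1 - a₁ / 2) (by
      rw [abs_lt]; constructor <;> linarith)
    nlinarith [sq_nonneg (ξ n).1]

/-- `ε`-dependent trace inequality
`‖φ‖_{L²(Σ)} ≤ C √(r_ε) ‖∇φ‖_{L²(Ω_ε)}`, with `r_ε = exp(−ε^{−α})`, for functions
vanishing on the sieve `Γ_ε = Σ \ ∪ₙ K̄ⁿ_ε`, with `C` independent of `ε`. -/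
theorem stmt6 (R h ε_star α δ₀ δ₁ : ℝ) (hR : 0 < R) (hh : 0 < h) (hα : 0 < α)
    (hδ₀ : 0 < δ₀) (hδ₁ : 0 < δ₁) (hεs : 0 < ε_star) :
    ∃ C > 0, ∀ ε ∈ Set.Ioc 0 ε_star,
      ∀ (N : ℕ) (ξ : Fin N → ℝ × ℝ) (K : Fin N → Set (ℝ × ℝ)),
      (∀ n, K n ⊆ Metric.ball (ξ n) (δ₀ * Real.exp (-ε ^ (-α)))) →
      δ₀ * Real.exp (-ε ^ (-α)) ≤ δ₁ * ε →
      (∀ n, Metric.ball (ξ n) (δ₁ * ε) ⊆ disk2 R) →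
      (Pairwise fun n m =>
        Disjoint (Metric.ball (ξ n) (δ₁ * ε)) (Metric.ball (ξ m) (δ₁ * ε))) →
      ∀ φ : (Fin 3 → ℝ) → ℝ, Differentiable ℝ φ →
      (∀ q : ℝ × ℝ, q ∈ disk2 R → (∀ n, q ∉ K n) → φ (emb q 0) = 0) →
      IntegrableOn (fun q => (φ (emb q 0)) ^ 2) (disk2 R) →
      IntegrableOn (fun x => ‖fderiv ℝ φ x‖ ^ 2)
        (cyl R h \ closure {p : Fin 3 → ℝ | p ∈ midDisk R ∧ ∀ n, (p 0, p 1) ∉ K n}) →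
      (∫ q in disk2 R, (φ (emb q 0)) ^ 2) ^ ((1:ℝ)/2)
        ≤ C * Real.sqrt (Real.exp (-ε ^ (-α))) *
            (∫ x in cyl R h \ closure {p : Fin 3 → ℝ | p ∈ midDisk R ∧ ∀ n, (p 0, p 1) ∉ K n},
              ‖fderiv ℝ φ x‖ ^ 2) ^ ((1:ℝ)/2) := by
  obtain ⟨X, hX⟩ := exists_X α (δ₁ / (3 * δ₀)) hα (by positivity)
  set a₁ := min (δ₀ * Real.exp (-X)) R with ha₁
  have ha₁pos : 0 < a₁ := lt_min (by positivity) hR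
  set A1 := 4 * (2 * δ₀ + h) ^ 2 * h⁻¹ with hA1
  set A2 := 4 * ((2 * R + h) ^ 2 * ((a₁ ^ 2 / (16 * R ^ 2)) ^ 2)⁻¹ * h⁻¹) with hA2
  have hA1p : 0 < A1 := by positivity
  have hA2p : 0 < A2 := by positivity
  set B := A1 + A2 * Real.exp X with hB
  have hBp : 0 < B := by positivity
  refine ⟨Real.sqrt B, Real.sqrt_pos.2 hBp, ?_⟩
  intro ε hε N ξ K hK hle hb hd φ hφ hz hi hj
  set r := Real.exp (-ε ^ (-α)) with hr
  have hrp : 0 < r := Real.exp_pos _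
  have hr1 : r ≤ 1 := by
    rw [hr, Real.exp_le_one_iff]
    have := Real.rpow_nonneg hε.1.le (-α)
    linarith
  have main : ∫ q in disk2 R, (φ (emb q 0)) ^ 2 ≤ (B * r) *
      ∫ x in cyl R h \ closure {p : Fin 3 → ℝ | p ∈ midDisk R ∧ ∀ n, (p 0, p 1) ∉ K n},
        ‖fderiv ℝ φ x‖ ^ 2 := by
    by_cases hc : 3 * (δ₀ * r) ≤ δ₁ * ε
    · refine final_conv φ R h (A1 * r) _ (by positivity) ?_ _ (fun p hp => hp.1.2) hi hj
        (case_far φ hφ R h δ₀ r (δ₁ * ε) hh hδ₀ hrp hr1 hc N ξ K hK hb hd hz)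
      gcongr
      rw [hB]
      have : 0 ≤ A2 * Real.exp X := by positivity
      linarith
    · have hlt : ε ^ (-α) < X := by
        refine hX ε hε.1 ?_
        rw [not_le] at hc
        rw [div_mul_eq_mul_div, div_lt_iff₀ (by positivity)]
        linarith
      have hrX : Real.exp (-X) ≤ r := Real.exp_le_exp.2 (by linarith)
      have ha : a₁ ≤ δ₁ * ε :=
        (min_le_left _ _).trans ((mul_le_mul_of_nonneg_left hrX hδ₀.le).trans hle)
      refine final_conv φ R h A2 _ hA2p.le ?_ _ (fun p hp => hp.1.2) hi hj
        (case_near φ hφ R h a₁ (δ₁ * ε) hR hh ha₁pos (min_le_right _ _) ha N ξ K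
          (fun n => (hK n).trans (Metric.ball_subset_ball hle)) hb hz)
      have h1 : 1 ≤ Real.exp X * r := by
        have : Real.exp X * Real.exp (-X) = 1 := by rw [← Real.exp_add]; simp
        rw [← this]
        gcongr
      rw [hB]
      nlinarith [mul_pos hA1p hrp, mul_le_mul_of_nonneg_left h1 hA2p.le]
  rw [← Real.sqrt_eq_rpow, ← Real.sqrt_eq_rpow, ← Real.sqrt_mul hBp.le,
    ← Real.sqrt_mul (by positivity)]
  exact Real.sqrt_le_sqrt main
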